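/- arXiv:2408.14455 — 4 statements merged into one kernel-verified Lean document; each statement's English description precedes it below -/
import Mathlib

section
/- Let w = (w_1,…,w_n) be a permutation of {1,…,n} whose ad-pattern contains the word ddaa as a contiguous factor, or begins with the word daa, or ends with the word dda. Then the chromatic quasisymmetric function of the labeled path P_w is not symmetric. -/
/-- A proper coloring of a labeled graph on vertex set `Fin n` (vertex `v` represents
label `v+1`), with colors in `{1,2,...}`. -/
def properColoring {n : ℕ} (G : SimpleGraph (Fin n)) (c : Fin n → ℕ) : Prop :=
  ∀ u v : Fin n, G.Adj u v → c u ≠ c v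

/-- The ascent number of a coloring: the number of edges `uv` with `u < v` and `c u < c v`. -/
noncomputable def ascNum {n : ℕ} (G : SimpleGraph (Fin n)) (c : Fin n → ℕ) : ℕ :=
  Nat.card {p : Fin n × Fin n // p.1 < p.2 ∧ G.Adj p.1 p.2 ∧ c p.1 < c p.2}

/-- The descent number of a coloring: the number of edges `uv` with `u < v` and `c u > c v`. -/
noncomputable def desNum {n : ℕ} (G : SimpleGraph (Fin n)) (c : Fin n → ℕ) : ℕ :=
  Nat.card {p : Fin n × Fin n // p.1 < p.2 ∧ G.Adj p.1 p.2 ∧ c p.2 < c p.1}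

/-- The coloring `c` uses exactly the colors `1,…,L.length`, color `a` being used
exactly `L.get (a-1)` times. -/
def usesPalette {n : ℕ} (L : List ℕ) (c : Fin n → ℕ) : Prop :=
  (∀ v : Fin n, 1 ≤ c v ∧ c v ≤ L.length) ∧
  ∀ i : Fin L.length, Nat.card {v : Fin n // c v = (i : ℕ) + 1} = L.get i

/-- `NG G L k` is the number of proper colorings of `G` with ascent number `k`
and palette `L`. -/
noncomputable def NG {n : ℕ} (G : SimpleGraph (Fin n)) (L : List ℕ) (k : ℕ) : ℕ :=
  Nat.card {c : Fin n → ℕ // properColoring G c ∧ usesPalette L c ∧ ascNum G c = k}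

/-- `L` is a composition of `n`: a list of positive integers summing to `n`. -/
def IsComposition (n : ℕ) (L : List ℕ) : Prop :=
  (∀ a ∈ L, 0 < a) ∧ L.sum = n

/-- The chromatic quasisymmetric function of `G` is symmetric. -/
def cqfSymmetric {n : ℕ} (G : SimpleGraph (Fin n)) : Prop :=
  ∀ L M : List ℕ, IsComposition n L → IsComposition n M → List.Perm L M →
    ∀ k : ℕ, NG G L k = NG G M k

/-- The number of edges of `G`. -/
noncomputable def edgeCount {n : ℕ} (G : SimpleGraph (Fin n)) : ℕ := Nat.card G.edgeSet

/-- The chromatic quasisymmetric function of `G` is palindromic. -/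
def cqfPalindromic {n : ℕ} (G : SimpleGraph (Fin n)) : Prop :=
  ∀ L : List ℕ, IsComposition n L →
    ∀ k : ℕ, k ≤ edgeCount G → NG G L k = NG G L (edgeCount G - k)

/-- The labeled path `P_w` of a permutation `w` of `Fin n`: edges `{w i, w (i+1)}`. -/
def pathGraph {n : ℕ} (w : Equiv.Perm (Fin n)) : SimpleGraph (Fin n) :=
  SimpleGraph.fromRel (fun u v => ∃ i : ℕ, ∃ h : i + 1 < n,
    u = w ⟨i, by omega⟩ ∧ v = w ⟨i + 1, h⟩)

/-- The flipped labeled graph: `uv` is an edge iff `(n+1-u)(n+1-v)` is an edge of `G`. -/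
def flipGraph {n : ℕ} (G : SimpleGraph (Fin n)) : SimpleGraph (Fin n) :=
  SimpleGraph.comap Fin.rev G

/-- The ascent-descent pattern of `w`, where `true` records an ascent (`a`) and
`false` records a descent (`d`). -/
def adPattern {n : ℕ} (w : Equiv.Perm (Fin n)) : List Bool :=
  List.ofFn (fun i : Fin (n - 1) =>
    decide (w ⟨(i : ℕ), by have := i.isLt; omega⟩ < w ⟨(i : ℕ) + 1, by have := i.isLt; omega⟩))

/-- The ribbon word `a^{α₁-1} d a^{α₂-1} d ⋯ d a^{α_ℓ-1}` of a composition. -/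
def ribbonWord : List ℕ → List Bool
  | [] => []
  | [a] => List.replicate (a - 1) true
  | a :: b :: rest => List.replicate (a - 1) true ++ false :: ribbonWord (b :: rest)

/-- Position `i` is a local minimum of `w`. -/
def LocalMinAt {n : ℕ} (w : Equiv.Perm (Fin n)) (i : Fin n) : Prop :=
  (∀ _ : 0 < (i : ℕ), w i < w ⟨(i : ℕ) - 1, by have := i.isLt; omega⟩) ∧
  (∀ h : (i : ℕ) + 1 < n, w i < w ⟨(i : ℕ) + 1, h⟩)

/-- Position `i` is a local maximum of `w`. -/
def LocalMaxAt {n : ℕ} (w : Equiv.Perm (Fin n)) (i : Fin n) : Prop :=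
  (∀ _ : 0 < (i : ℕ), w ⟨(i : ℕ) - 1, by have := i.isLt; omega⟩ < w i) ∧
  (∀ h : (i : ℕ) + 1 < n, w ⟨(i : ℕ) + 1, h⟩ < w i)

/-- The labeled star `K_{1,n-1}` with central vertex `j`. -/
def starGraph (n : ℕ) (j : Fin n) : SimpleGraph (Fin n) :=
  SimpleGraph.fromRel (fun u v => u = j ∧ v ≠ j)

open Finset in
/-- A coloring with as many ascents as one in which every edge is an ascent has only ascents. -/
theorem lt_of_ascNum_eq {n : ℕ} {G : SimpleGraph (Fin n)} {c d : Fin n → ℕ}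
    (hd : ∀ u v, G.Adj u v → u < v → d u < d v) (h : ascNum G c = ascNum G d)
    {u v : Fin n} (huv : G.Adj u v) (hlt : u < v) : c u < c v := by
  classical
  unfold ascNum at h
  rw [Nat.card_eq_fintype_card, Nat.card_eq_fintype_card, Fintype.card_subtype,
    Fintype.card_subtype] at h
  have hsub : (univ.filter fun p : Fin n × Fin n => p.1 < p.2 ∧ G.Adj p.1 p.2 ∧ c p.1 < c p.2) ⊆
      univ.filter fun p : Fin n × Fin n => p.1 < p.2 ∧ G.Adj p.1 p.2 ∧ d p.1 < d p.2 := by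
    intro p hp
    simp only [mem_filter, mem_univ, true_and] at hp ⊢
    exact ⟨hp.1, hp.2.1, hd _ _ hp.2.1 hp.1⟩
  have heq := eq_of_subset_of_card_le hsub h.ge
  have hmem : (u, v) ∈ univ.filter
      fun p : Fin n × Fin n => p.1 < p.2 ∧ G.Adj p.1 p.2 ∧ d p.1 < d p.2 := by
    simp [hlt, huv, hd u v huv hlt]
  rw [← heq] at hmem
  simpa [hlt, huv] using hmem

theorem finite_usesPalette {n : ℕ} (L : List ℕ) : {c : Fin n → ℕ | usesPalette L c}.Finite := by
  refine (Set.Finite.pi' (t := fun _ : Fin n => Set.Iic L.length)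
    fun _ => Set.finite_Iic _).subset ?_
  intro c hc v
  exact (hc.1 v).2

/-- The palette `1, |S|, 1, …, 1` is realized by an everywhere ascending coloring as soon as
`S` is an antichain lying directly above the bottom vertex `z`. -/
theorem exists_ascending_coloring {n : ℕ} {G : SimpleGraph (Fin n)} {z : Fin n}
    {S : Finset (Fin n)} (hzS : z ∉ S) (hz : ∀ u, G.Adj u z → z < u)
    (hS : ∀ s ∈ S, ∀ u, G.Adj u s → u < s → u = z) :
    ∃ c : Fin n → ℕ, (∀ u v, G.Adj u v → u < v → c u < c v) ∧
      usesPalette (1 :: S.card :: List.replicate (n - 1 - S.card) 1) c := by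
  classical
  let R : Finset (Fin n) := (insert z S)ᶜ
  have hR : ∀ v, v ∈ R ↔ v ≠ z ∧ v ∉ S := by intro v; simp [R]
  have hRcard : R.card = n - 1 - S.card := by
    simp only [R, Finset.card_compl, Finset.card_insert_of_notMem hzS, Fintype.card_fin]
    omega
  let e := R.orderIsoOfFin hRcard
  let c : Fin n → ℕ := fun v => if h : v ∈ R then (e.symm ⟨v, h⟩ : ℕ) + 3
    else if v = z then 1 else 2
  have cR : ∀ v (h : v ∈ R), c v = (e.symm ⟨v, h⟩ : ℕ) + 3 := fun v h => by simp [c, h]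
  have cz : c z = 1 := by simp [c, hR]
  have cS : ∀ v ∈ S, c v = 2 := fun v h => by
    have hvz : v ≠ z := fun h' => hzS (h' ▸ h)
    simp [c, hR, h, hvz]
  have trichotomy : ∀ v, v ∈ R ∨ v = z ∨ v ∈ S := by
    intro v; rw [hR]; tauto
  refine ⟨c, ?_, ?_, ?_⟩
  · intro u v huv hlt
    rcases trichotomy v with hv | rfl | hv
    · rw [cR v hv]
      rcases trichotomy u with hu | rfl | hu
      · rw [cR u hu]
        have : e.symm ⟨u, hu⟩ < e.symm ⟨v, hv⟩ := e.symm.lt_iff_lt.2 hlt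
        have : (e.symm ⟨u, hu⟩ : ℕ) < e.symm ⟨v, hv⟩ := this
        omega
      · rw [cz]; omega
      · rw [cS u hu]; omega
    · exact absurd (hz u huv) hlt.asymm
    · rw [hS v hv u huv hlt, cz, cS v hv]; omega
  · intro v
    simp only [List.length_cons, List.length_replicate]
    rcases trichotomy v with hv | rfl | hv
    · rw [cR v hv]
      have := (e.symm ⟨v, hv⟩).isLt
      omega
    · rw [cz]; omega
    · rw [cS v hv]; omega
  · rintro ⟨i, hi⟩
    simp only [List.length_cons, List.length_replicate] at hi
    rw [Nat.card_eq_fintype_card, Fintype.card_subtype]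
    match i, hi with
    | 0, _ =>
      have : (Finset.univ.filter fun v => c v = 0 + 1) = {z} := by
        ext v
        simp only [Finset.mem_filter, Finset.mem_univ, true_and, Finset.mem_singleton]
        refine ⟨fun h => ?_, fun h => by rw [h, cz]⟩
        rcases trichotomy v with hv | hv | hv
        · rw [cR v hv] at h; omega
        · exact hv
        · rw [cS v hv] at h; omega
      simp [this]
    | 1, _ =>
      have : (Finset.univ.filter fun v => c v = 1 + 1) = S := by
        ext v
        simp only [Finset.mem_filter, Finset.mem_univ, true_and]
        refine ⟨fun h => ?_, fun h => cS v h⟩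
        rcases trichotomy v with hv | rfl | hv
        · rw [cR v hv] at h; omega
        · rw [cz] at h; omega
        · exact hv
      simp [this]
    | j + 2, hj =>
      have hj' : j < n - 1 - S.card := by omega
      have : (Finset.univ.filter fun v => c v = j + 2 + 1) = {(e ⟨j, hj'⟩ : Fin n)} := by
        ext v
        simp only [Finset.mem_filter, Finset.mem_univ, true_and, Finset.mem_singleton]
        constructor
        · intro h
          rcases trichotomy v with hv | rfl | hv
          · rw [cR v hv] at h
            have : e.symm ⟨v, hv⟩ = ⟨j, hj'⟩ := Fin.ext (by simp only; omega)
            rw [← this, e.apply_symm_apply]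
          · rw [cz] at h; omega
          · rw [cS v hv] at h; omega
        · rintro rfl
          rw [cR _ (e ⟨j, hj'⟩).2]
          simp
      simp [this]

open Finset in
/-- If some antichain lying directly above a bottom vertex is larger than the set of all minimal
vertices, then the chromatic quasisymmetric function is not symmetric. -/
theorem not_cqfSymmetric_of_card_lt {n : ℕ} {G : SimpleGraph (Fin n)} {z : Fin n}
    {S : Finset (Fin n)} (hzS : z ∉ S) (hz : ∀ u, G.Adj u z → z < u)
    (hS : ∀ s ∈ S, ∀ u, G.Adj u s → u < s → u = z)
    (hcard : Nat.card {v : Fin n // ∀ u, G.Adj u v → v < u} < S.card) : ¬ cqfSymmetric G := by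
  classical
  intro hsymm
  obtain ⟨d, hd, hdp⟩ := exists_ascending_coloring hzS hz hS
  have hle : S.card + 1 ≤ n := by
    rw [← card_insert_of_notMem hzS]
    simpa using card_le_univ (insert z S)
  have key := hsymm (1 :: S.card :: List.replicate (n - 1 - S.card) 1)
    (S.card :: 1 :: List.replicate (n - 1 - S.card) 1)
    ⟨fun a ha => ?_, by simp; omega⟩ ⟨fun a ha => ?_, by simp; omega⟩
    (List.Perm.swap _ _ _) (ascNum G d)
  rotate_left
  iterate 2
    simp only [List.mem_cons, List.mem_replicate] at ha
    omega
  have hproper : properColoring G d := by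
    intro u v huv
    rcases lt_trichotomy u v with h | h | h
    · exact (hd u v huv h).ne
    · exact absurd h huv.ne
    · exact (hd v u huv.symm h).ne'
  have hfin : Finite {c : Fin n → ℕ // properColoring G c ∧
      usesPalette (1 :: S.card :: List.replicate (n - 1 - S.card) 1) c ∧
      ascNum G c = ascNum G d} :=
    ((finite_usesPalette _).subset fun c hc => hc.2.1).to_subtype
  have hpos : 0 < NG G (1 :: S.card :: List.replicate (n - 1 - S.card) 1) (ascNum G d) :=
    Nat.card_pos_iff.2 ⟨⟨⟨d, hproper, hdp, rfl⟩⟩, hfin⟩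
  rw [key] at hpos
  obtain ⟨⟨c, -, hcp, hca⟩⟩ := (Nat.card_pos_iff.1 hpos).1
  have hfib := hcp.2 ⟨0, by simp⟩
  simp only [List.get_eq_getElem, List.getElem_cons_zero] at hfib
  rw [← hfib] at hcard
  refine hcard.not_ge (Nat.card_le_card_of_injective
    (Subtype.map id fun v hv u huv => ?_) (Subtype.map_injective _ Function.injective_id))
  by_contra hlt
  have := lt_of_ascNum_eq hd hca huv (lt_of_le_of_ne (not_lt.1 hlt) huv.ne)
  have := (hcp.1 u).1
  simp only [id] at *
  omega

/-- A bottom vertex `z` below two vertices `x`, `y` whose only lower neighbor is `z` prevents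
symmetry. -/
theorem not_cqfSymmetric_of_two_covers {n : ℕ} {G : SimpleGraph (Fin n)} {x y z : Fin n}
    (hxy : x ≠ y) (hzx : z < x) (hzy : z < y) (hax : G.Adj z x) (hay : G.Adj z y)
    (hz : ∀ u, G.Adj u z → z < u) (hx : ∀ u, G.Adj u x → u < x → u = z)
    (hy : ∀ u, G.Adj u y → u < y → u = z) : ¬ cqfSymmetric G := by
  classical
  let M : Finset (Fin n) := Finset.univ.filter fun v => ∀ u, G.Adj u v → v < u
  have hM : ∀ v, v ∈ M ↔ ∀ u, G.Adj u v → v < u := by simp [M]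
  have hzM : z ∈ M := (hM z).2 hz
  have hxM : x ∉ M := fun h => ((hM x).1 h z hax).asymm hzx
  have hyM : y ∉ M := fun h => ((hM y).1 h z hay).asymm hzy
  refine not_cqfSymmetric_of_card_lt (z := z) (S := insert x (insert y (M.erase z))) ?_ hz ?_ ?_
  · simp [hzx.ne, hzy.ne]
  · intro s hs u hus hlt
    simp only [Finset.mem_insert, Finset.mem_erase] at hs
    rcases hs with rfl | rfl | hs
    · exact hx u hus hlt
    · exact hy u hus hlt
    · exact absurd ((hM s).1 hs.2 u hus) hlt.asymm
  · rw [Finset.card_insert_of_notMem (by simp [hxy, hxM]),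
      Finset.card_insert_of_notMem (by simp [hyM]), Finset.card_erase_add_one hzM,
      Nat.card_eq_fintype_card, Fintype.card_subtype]
    exact Nat.lt_succ_self _

theorem pathGraph_adj_iff {n : ℕ} (w : Equiv.Perm (Fin n)) (i j : Fin n) :
    (pathGraph w).Adj (w i) (w j) ↔ (i : ℕ) + 1 = j ∨ (j : ℕ) + 1 = i := by
  simp only [pathGraph, SimpleGraph.fromRel_adj, ne_eq, EmbeddingLike.apply_eq_iff_eq]
  constructor
  · rintro ⟨-, ⟨k, h, rfl, rfl⟩ | ⟨k, h, rfl, rfl⟩⟩ <;> simp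
  · rintro (h | h)
    · exact ⟨by rintro rfl; omega, Or.inl ⟨i, by omega, rfl, Fin.ext h.symm⟩⟩
    · exact ⟨by rintro rfl; omega, Or.inr ⟨j, by omega, rfl, Fin.ext h.symm⟩⟩

/-- A valley of the path both of whose slopes have length at least two, or reach the end of the
path after one step, prevents symmetry. -/
theorem not_cqfSymmetric_pathGraph_of_valley {n : ℕ} (w : Equiv.Perm (Fin n)) {p : ℕ}
    (hp : p + 2 < n) (hl : w ⟨p + 1, by omega⟩ < w ⟨p, by omega⟩)
    (hr : w ⟨p + 1, by omega⟩ < w ⟨p + 2, hp⟩)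
    (hll : ∀ (q : ℕ) (hq : q + 1 = p), w ⟨p, by omega⟩ < w ⟨q, by omega⟩)
    (hrr : ∀ h : p + 3 < n, w ⟨p + 2, hp⟩ < w ⟨p + 3, h⟩) :
    ¬ cqfSymmetric (pathGraph w) := by
  refine not_cqfSymmetric_of_two_covers (x := w ⟨p, by omega⟩) (y := w ⟨p + 2, hp⟩)
    (z := w ⟨p + 1, by omega⟩) (by simp) hl hr
    ((pathGraph_adj_iff ..).2 (by simp)) ((pathGraph_adj_iff ..).2 (by simp)) ?_ ?_ ?_
  all_goals
    intro u
    obtain ⟨⟨i, hi⟩, rfl⟩ := w.surjective u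
    rw [pathGraph_adj_iff]
    simp only
  · rintro (h | h)
    · obtain rfl : i = p := by omega
      exact hl
    · obtain rfl : i = p + 2 := by omega
      exact hr
  · rintro (h | h) hlt
    · exact absurd (hll i h) hlt.asymm
    · subst h
      rfl
  · rintro (h | h) hlt
    · obtain rfl : i = p + 1 := by omega
      rfl
    · obtain rfl : i = p + 3 := by omega
      exact absurd (hrr hi) hlt.asymm

theorem length_adPattern {n : ℕ} (w : Equiv.Perm (Fin n)) : (adPattern w).length = n - 1 := by
  simp [adPattern]

theorem lt_of_adPattern_eq_true {n : ℕ} {w : Equiv.Perm (Fin n)} {i : ℕ}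
    (h : (adPattern w)[i]? = some true) (hi : i + 1 < n) :
    w ⟨i, by omega⟩ < w ⟨i + 1, hi⟩ := by
  have hi' : i < n - 1 := by omega
  simpa [adPattern, List.getElem?_ofFn, hi'] using h

theorem lt_of_adPattern_eq_false {n : ℕ} {w : Equiv.Perm (Fin n)} {i : ℕ}
    (h : (adPattern w)[i]? = some false) (hi : i + 1 < n) :
    w ⟨i + 1, hi⟩ < w ⟨i, by omega⟩ := by
  have hi' : i < n - 1 := by omega
  refine lt_of_le_of_ne ?_ (by simp)
  simpa [adPattern, List.getElem?_ofFn, hi'] using h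

/-- If the ad-pattern of `w` contains `ddaa` as a contiguous factor,
or begins with `daa`, or ends with `dda`, then the CQF of `P_w` is not symmetric.
(Here `true` records `a` and `false` records `d`.) -/
theorem stmt8 (n : ℕ) (w : Equiv.Perm (Fin n))
    (h : [false, false, true, true] <:+: adPattern w ∨
         [false, true, true] <+: adPattern w ∨
         [false, false, true] <:+ adPattern w) :
    ¬ cqfSymmetric (pathGraph w) := by
  rcases h with ⟨s, t, h⟩ | ⟨t, h⟩ | ⟨s, h⟩
  · have hlen := congrArg List.length h
    simp only [List.length_append, List.length_cons, List.length_nil, length_adPattern] at hlen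
    refine not_cqfSymmetric_pathGraph_of_valley w (p := s.length + 1) (by omega)
      (lt_of_adPattern_eq_false ?_ _) (lt_of_adPattern_eq_true ?_ _) ?_
      fun _ => lt_of_adPattern_eq_true ?_ _
    · simp [← h, add_assoc]
    · simp [← h, add_assoc]
    · intro q hq
      obtain rfl : q = s.length := by omega
      exact lt_of_adPattern_eq_false (by simp [← h]) _
    · simp [← h, add_assoc]
  · have hlen := congrArg List.length h
    simp only [List.length_append, List.length_cons, List.length_nil, length_adPattern] at hlen
    refine not_cqfSymmetric_pathGraph_of_valley w (p := 0) (by omega)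
      (lt_of_adPattern_eq_false ?_ _) (lt_of_adPattern_eq_true ?_ _) (fun q hq => by omega)
      fun _ => lt_of_adPattern_eq_true ?_ _
    all_goals simp [← h]
  · have hlen := congrArg List.length h
    simp only [List.length_append, List.length_cons, List.length_nil, length_adPattern] at hlen
    refine not_cqfSymmetric_pathGraph_of_valley w (p := s.length + 1) (by omega)
      (lt_of_adPattern_eq_false ?_ _) (lt_of_adPattern_eq_true ?_ _) ?_ fun _ => by omega
    · simp [← h]
    · simp [← h, add_assoc]
    · intro q hq
      obtain rfl : q = s.length := by omega
      exact lt_of_adPattern_eq_false (by simp [← h]) _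
end

section
/- Let n ≥ 3, let 1 ≤ j ≤ n, and let G be the labeled star K_{1,n−1} on {1,…,n} with central vertex j. Then the chromatic quasisymmetric function of G is palindromic if and only if n is odd and j = (n+1)/2. -/
theorem edgeCount_eq_ascNum_add_desNum {n : ℕ} {G : SimpleGraph (Fin n)} {c : Fin n → ℕ}
    (hc : properColoring G c) : edgeCount G = ascNum G c + desNum G c := by
  classical
  let f : {p : Fin n × Fin n // p.1 < p.2 ∧ G.Adj p.1 p.2} → G.edgeSet :=
    fun p => ⟨s(p.1.1, p.1.2), p.2.2⟩
  have hf : Function.Bijective f := by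
    constructor
    · rintro ⟨⟨a, b⟩, h, _⟩ ⟨⟨a', b'⟩, h', _⟩ heq
      have heq : s(a, b) = s(a', b') := congrArg Subtype.val heq
      rw [Sym2.eq_iff] at heq
      rcases heq with ⟨rfl, rfl⟩ | ⟨rfl, rfl⟩
      · rfl
      · exact absurd h (lt_asymm h')
    · rintro ⟨e, he⟩
      induction e with
      | h a b =>
        have hab : G.Adj a b := he
        rcases lt_or_gt_of_ne hab.ne with h | h
        · exact ⟨⟨(a, b), h, hab⟩, rfl⟩
        · exact ⟨⟨(b, a), h, hab.symm⟩, Subtype.ext Sym2.eq_swap⟩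
  unfold edgeCount ascNum desNum
  rw [← Nat.card_congr (Equiv.ofBijective f hf)]
  simp only [Nat.card_eq_fintype_card, Fintype.card_subtype]
  rw [← Finset.card_union_of_disjoint]
  · congr 1
    ext p
    have := hc p.1 p.2
    simp only [Finset.mem_filter, Finset.mem_univ, true_and, Finset.mem_union]
    grind
  · rw [Finset.disjoint_filter]
    rintro p - ⟨-, -, h⟩ ⟨-, -, h'⟩
    exact lt_asymm h h'

theorem ascNum_comp_rev {n : ℕ} {G : SimpleGraph (Fin n)}
    (hG : ∀ u v, G.Adj u.rev v.rev ↔ G.Adj u v) (c : Fin n → ℕ) :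
    ascNum G (c ∘ Fin.rev) = desNum G c :=
  Nat.card_congr
    { toFun := fun p => ⟨(p.1.2.rev, p.1.1.rev), Fin.rev_lt_rev.2 p.2.1,
        (hG _ _).2 p.2.2.1.symm, p.2.2.2⟩
      invFun := fun p => ⟨(p.1.2.rev, p.1.1.rev), Fin.rev_lt_rev.2 p.2.1,
        (hG _ _).2 p.2.2.1.symm, by simpa using p.2.2.2⟩
      left_inv := fun p => by simp
      right_inv := fun p => by simp }

theorem properColoring.comp_rev {n : ℕ} {G : SimpleGraph (Fin n)}
    (hG : ∀ u v, G.Adj u.rev v.rev ↔ G.Adj u v) {c : Fin n → ℕ} (hc : properColoring G c) :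
    properColoring G (c ∘ Fin.rev) :=
  fun u v h => hc _ _ ((hG u v).2 h)

theorem usesPalette.comp_rev {n : ℕ} {L : List ℕ} {c : Fin n → ℕ} (hc : usesPalette L c) :
    usesPalette L (c ∘ Fin.rev) := by
  refine ⟨fun v => hc.1 _, fun i => ?_⟩
  rw [← hc.2 i]
  exact Nat.card_congr (Fin.revPerm.subtypeEquiv fun v => by simp)

theorem comp_rev_comp_rev {n : ℕ} (c : Fin n → ℕ) : (c ∘ Fin.rev) ∘ Fin.rev = c := by
  ext v
  simp

/-- A graph invariant under reversing its labels has a palindromic CQF. -/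
theorem cqfPalindromic_of_rev_invariant {n : ℕ} {G : SimpleGraph (Fin n)}
    (hG : ∀ u v, G.Adj u.rev v.rev ↔ G.Adj u v) : cqfPalindromic G := by
  intro L _ k hk
  refine Nat.card_congr
    { toFun := fun c => ⟨c.1 ∘ Fin.rev, c.2.1.comp_rev hG, c.2.2.1.comp_rev, ?_⟩
      invFun := fun c => ⟨c.1 ∘ Fin.rev, c.2.1.comp_rev hG, c.2.2.1.comp_rev, ?_⟩
      left_inv := fun c => Subtype.ext (comp_rev_comp_rev _)
      right_inv := fun c => Subtype.ext (comp_rev_comp_rev _) }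
  all_goals
    have h := edgeCount_eq_ascNum_add_desNum c.2.1
    have h' := c.2.2.2
    rw [ascNum_comp_rev hG]
    omega

theorem starGraph_adj {n : ℕ} {j u v : Fin n} :
    (starGraph n j).Adj u v ↔ u = j ∧ v ≠ j ∨ v = j ∧ u ≠ j := by
  simp only [starGraph, SimpleGraph.fromRel_adj]
  grind

/-- The coloring of the star giving its center color `1` and its leaves color `2`. -/
def centerLeafColoring {n : ℕ} (j : Fin n) (v : Fin n) : ℕ := if v = j then 1 else 2

theorem properColoring_centerLeafColoring {n : ℕ} (j : Fin n) :
    properColoring (starGraph n j) (centerLeafColoring j) := by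
  intro u v h
  rw [starGraph_adj] at h
  grind [centerLeafColoring]

theorem usesPalette_centerLeafColoring {n : ℕ} (j : Fin n) :
    usesPalette [1, n - 1] (centerLeafColoring j) := by
  constructor
  · intro v
    unfold centerLeafColoring
    split_ifs <;> simp
  · intro i
    simp only [Nat.card_eq_fintype_card]
    fin_cases i <;> simp [centerLeafColoring]

theorem eq_centerLeafColoring {n : ℕ} (hn : 3 ≤ n) {j : Fin n} {c : Fin n → ℕ}
    (hc : properColoring (starGraph n j) c) (hL : usesPalette [1, n - 1] c) :
    c = centerLeafColoring j := by
  have hne : ∀ v, v ≠ j → c v ≠ c j := fun v hv => hc v j (starGraph_adj.2 (Or.inr ⟨rfl, hv⟩))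
  have hle : ∀ v, 1 ≤ c v ∧ c v ≤ 2 := hL.1
  have hj : c j ≠ 2 := by
    intro h2
    have hcard : Nat.card {v : Fin n // c v = 2} = n - 1 := hL.2 ⟨1, by simp⟩
    have : Subsingleton {v : Fin n // c v = 2} :=
      ⟨fun a b => Subtype.ext (by have := hne a; have := hne b; grind)⟩
    have := Finite.card_le_one_iff_subsingleton.2 this
    omega
  ext v
  have := hle v
  have := hle j
  have := hne v
  unfold centerLeafColoring
  grind

theorem ascNum_centerLeafColoring {n : ℕ} (j : Fin n) :
    ascNum (starGraph n j) (centerLeafColoring j) = n - 1 - j := by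
  rw [← Fin.card_Ioi, ← Nat.card_eq_finsetCard]
  refine Nat.card_congr
    { toFun := fun p => ⟨p.1.2, ?_⟩
      invFun := fun v => ⟨(j, v.1), ?_⟩
      left_inv := ?_
      right_inv := fun v => rfl }
  · have := p.2
    grind [centerLeafColoring, starGraph_adj]
  · have := v.2
    grind [centerLeafColoring, starGraph_adj]
  · rintro ⟨⟨u, v⟩, h⟩
    grind [centerLeafColoring, starGraph_adj]

theorem desNum_centerLeafColoring {n : ℕ} (j : Fin n) :
    desNum (starGraph n j) (centerLeafColoring j) = j := by
  rw [← Fin.card_Iio j, ← Nat.card_eq_finsetCard]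
  refine Nat.card_congr
    { toFun := fun p => ⟨p.1.1, ?_⟩
      invFun := fun v => ⟨(v.1, j), ?_⟩
      left_inv := ?_
      right_inv := fun v => rfl }
  · have := p.2
    grind [centerLeafColoring, starGraph_adj]
  · have := v.2
    grind [centerLeafColoring, starGraph_adj]
  · rintro ⟨⟨u, v⟩, h⟩
    grind [centerLeafColoring, starGraph_adj]

theorem NG_starGraph_eq_ite {n : ℕ} (hn : 3 ≤ n) (j : Fin n) (k : ℕ) :
    NG (starGraph n j) [1, n - 1] k = if k = n - 1 - j then 1 else 0 := by
  have hasc := ascNum_centerLeafColoring j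
  have huniq : ∀ c : {c : Fin n → ℕ // properColoring (starGraph n j) c ∧
      usesPalette [1, n - 1] c ∧ ascNum (starGraph n j) c = k}, c.1 = centerLeafColoring j :=
    fun c => eq_centerLeafColoring hn c.2.1 c.2.2.1
  unfold NG
  split_ifs with hk
  · rw [Nat.card_eq_one_iff_unique]
    exact ⟨⟨fun c d => Subtype.ext ((huniq c).trans (huniq d).symm)⟩,
      ⟨⟨_, properColoring_centerLeafColoring j, usesPalette_centerLeafColoring j,
        hasc.trans hk.symm⟩⟩⟩
  · have : IsEmpty {c : Fin n → ℕ // properColoring (starGraph n j) c ∧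
        usesPalette [1, n - 1] c ∧ ascNum (starGraph n j) c = k} :=
      ⟨fun c => hk (by rw [← c.2.2.2, huniq c, hasc])⟩
    exact Nat.card_of_isEmpty

/-- For `n ≥ 3`, the CQF of the labeled star `K_{1,n-1}` with central
vertex labeled `j+1` is palindromic iff `n` is odd and the central label `j+1` equals
`(n+1)/2`. -/
theorem stmt11 (n : ℕ) (hn : 3 ≤ n) (j : Fin n) :
    cqfPalindromic (starGraph n j) ↔ (Odd n ∧ 2 * ((j : ℕ) + 1) = n + 1) := by
  constructor
  · intro h
    have hedge := edgeCount_eq_ascNum_add_desNum (properColoring_centerLeafColoring j)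
    rw [ascNum_centerLeafColoring, desNum_centerLeafColoring] at hedge
    have hcomp : IsComposition n [1, n - 1] := by
      refine ⟨?_, ?_⟩ <;> simp <;> omega
    have heq := h _ hcomp (n - 1 - j) (by omega)
    rw [NG_starGraph_eq_ite hn, NG_starGraph_eq_ite hn, if_pos rfl] at heq
    have hj : edgeCount (starGraph n j) - (n - 1 - j) = n - 1 - j := by
      by_contra hne
      simp [hne] at heq
    exact ⟨⟨j, by omega⟩, by omega⟩
  · rintro ⟨-, hj⟩
    apply cqfPalindromic_of_rev_invariant
    have hrev : ∀ u : Fin n, u.rev = j ↔ u = j := by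
      intro u
      simp only [Fin.ext_iff, Fin.val_rev]
      omega
    intro u v
    simp only [starGraph_adj, ne_eq, hrev]
end

section
/- Let G be a connected labeled graph on n vertices whose vertex set {1,…,n} is partitioned into two nonempty disjoint independent sets A and B with |A| ≠ |B|, and suppose the number of edges of G is odd. Then the chromatic quasisymmetric function of G is not palindromic, and in particular not symmetric. -/
theorem ascNum_add_desNum {n : ℕ} (G : SimpleGraph (Fin n)) {c : Fin n → ℕ}
    (hc : properColoring G c) : ascNum G c + desNum G c = edgeCount G := by
  set S : Set (Fin n × Fin n) := {p | p.1 < p.2 ∧ G.Adj p.1 p.2 ∧ c p.1 < c p.2}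
  set T : Set (Fin n × Fin n) := {p | p.1 < p.2 ∧ G.Adj p.1 p.2 ∧ c p.2 < c p.1}
  have hST : Disjoint S T :=
    Set.disjoint_left.2 fun p hS hT => lt_asymm hS.2.2 hT.2.2
  have himage : (fun p : Fin n × Fin n => s(p.1, p.2)) '' (S ∪ T) = G.edgeSet := by
    ext e
    induction e with | _ u v
    constructor
    · rintro ⟨p, hp | hp, he⟩
      · exact he ▸ hp.2.1
      · exact he ▸ hp.2.1
    · intro huv
      have hadj : G.Adj u v := huv
      rcases lt_or_gt_of_ne hadj.ne with h | h
      · refine ⟨(u, v), ?_, rfl⟩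
        rcases lt_or_gt_of_ne (hc u v hadj) with h' | h'
        · exact Or.inl ⟨h, hadj, h'⟩
        · exact Or.inr ⟨h, hadj, h'⟩
      · refine ⟨(v, u), ?_, Sym2.eq_swap⟩
        rcases lt_or_gt_of_ne (hc v u hadj.symm) with h' | h'
        · exact Or.inl ⟨h, hadj.symm, h'⟩
        · exact Or.inr ⟨h, hadj.symm, h'⟩
  have hinj : Set.InjOn (fun p : Fin n × Fin n => s(p.1, p.2)) (S ∪ T) := by
    have hlt : ∀ p ∈ S ∪ T, p.1 < p.2 := fun p hp => hp.elim And.left And.left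
    rintro ⟨a, b⟩ hp ⟨a', b'⟩ hq h
    have h₁ := hlt _ hp
    have h₂ := hlt _ hq
    rcases Sym2.eq_iff.1 h with ⟨h, h'⟩ | ⟨h, h'⟩
    · exact Prod.ext h h'
    · dsimp only at h h' h₁ h₂
      subst h h'
      exact absurd h₁ (lt_asymm h₂)
  have hcard : (S ∪ T).ncard = G.edgeSet.ncard := by
    rw [← himage, hinj.ncard_image]
  rw [Set.ncard_union_eq hST (Set.toFinite S) (Set.toFinite T)] at hcard
  exact hcard

/-- On a connected graph, a proper 2-coloring with color classes of distinct prescribed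
sizes is unique. -/
theorem eq_of_usesPalette_pair {n : ℕ} {G : SimpleGraph (Fin n)} (hG : G.Connected)
    {a b : ℕ} (hab : a ≠ b) {c d : Fin n → ℕ} (hc : properColoring G c)
    (hd : properColoring G d) (hcL : usesPalette [a, b] c) (hdL : usesPalette [a, b] d) :
    c = d := by
  have hc' : ∀ v, 1 ≤ c v ∧ c v ≤ 2 := hcL.1
  have hd' : ∀ v, 1 ≤ d v ∧ d v ≤ 2 := hdL.1
  have hstep : ∀ u v, G.Adj u v → (c u = d u ↔ c v = d v) := by
    intro u v huv
    have := hc u v huv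
    have := hd u v huv
    have := hc' u
    have := hc' v
    have := hd' u
    have := hd' v
    omega
  have hconst : ∀ u v, c u = d u ↔ c v = d v := by
    intro u v
    obtain ⟨w⟩ := hG.preconnected u v
    induction w with
    | nil => rfl
    | cons h _ ih => exact (hstep _ _ h).trans ih
  by_contra hne
  obtain ⟨v, hv⟩ := Function.ne_iff.1 hne
  have hswap : ∀ u, c u = 1 ↔ d u = 2 := by
    intro u
    have := (hconst u v).not.2 hv
    have := hc' u
    have := hd' u
    omega
  have h₁ : Nat.card {u // c u = 1} = a := hcL.2 0
  have h₂ : Nat.card {u // d u = 2} = b := hdL.2 1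
  exact hab (h₁.symm.trans ((Nat.card_congr (Equiv.subtypeEquivRight hswap)).trans h₂))

theorem NG_pair_ne_zero_iff {n : ℕ} {G : SimpleGraph (Fin n)} (hG : G.Connected)
    {a b : ℕ} (hab : a ≠ b) {c : Fin n → ℕ} (hc : properColoring G c)
    (hcL : usesPalette [a, b] c) (k : ℕ) : NG G [a, b] k ≠ 0 ↔ ascNum G c = k := by
  have : Subsingleton
      {d : Fin n → ℕ // properColoring G d ∧ usesPalette [a, b] d ∧ ascNum G d = k} :=
    ⟨fun x y => Subtype.ext
      (eq_of_usesPalette_pair hG hab x.2.1 y.2.1 x.2.2.1 y.2.2.1)⟩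
  rw [NG, Nat.card_ne_zero]
  constructor
  · rintro ⟨⟨d, hd, hdL, hk⟩, -⟩
    rwa [eq_of_usesPalette_pair hG hab hc hd hcL hdL]
  · exact fun h => ⟨⟨c, hc, hcL, h⟩, inferInstance⟩

/-- The coloring with color `1` on `A` and color `2` off `A`. -/
def twoColoring {n : ℕ} (A : Finset (Fin n)) (v : Fin n) : ℕ := if v ∈ A then 1 else 2

theorem twoColoring_eq_one_iff {n : ℕ} {A : Finset (Fin n)} {v : Fin n} :
    twoColoring A v = 1 ↔ v ∈ A := by
  simp [twoColoring]

theorem twoColoring_eq_two_iff {n : ℕ} {A : Finset (Fin n)} {v : Fin n} :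
    twoColoring A v = 2 ↔ v ∈ Aᶜ := by
  simp [twoColoring]

theorem usesPalette_twoColoring {n : ℕ} (A : Finset (Fin n)) :
    usesPalette [A.card, Aᶜ.card] (twoColoring A) := by
  refine ⟨fun v => ?_, fun i => ?_⟩
  · unfold twoColoring
    split_ifs <;> simp
  · fin_cases i
    · exact (Nat.card_congr (Equiv.subtypeEquivRight fun _ => twoColoring_eq_one_iff)).trans
        (Nat.card_eq_card_toFinset (A : Set (Fin n)) |>.trans (by simp))
    · exact (Nat.card_congr (Equiv.subtypeEquivRight fun _ => twoColoring_eq_two_iff)).trans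
        (Nat.card_eq_card_toFinset ((Aᶜ : Finset (Fin n)) : Set (Fin n)) |>.trans (by simp))

theorem properColoring_twoColoring {n : ℕ} {G : SimpleGraph (Fin n)} {A : Finset (Fin n)}
    (hA : ∀ u ∈ A, ∀ v ∈ A, ¬ G.Adj u v) (hAc : ∀ u ∈ Aᶜ, ∀ v ∈ Aᶜ, ¬ G.Adj u v) :
    properColoring G (twoColoring A) := by
  intro u v huv h
  by_cases hu : u ∈ A
  · exact hA u hu v
      (twoColoring_eq_one_iff.1 (h.symm.trans (twoColoring_eq_one_iff.2 hu))) huv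
  · have hu' := Finset.mem_compl.2 hu
    exact hAc u hu' v
      (twoColoring_eq_two_iff.1 (h.symm.trans (twoColoring_eq_two_iff.2 hu'))) huv

theorem ascNum_twoColoring_compl {n : ℕ} (G : SimpleGraph (Fin n)) (A : Finset (Fin n)) :
    ascNum G (twoColoring Aᶜ) = desNum G (twoColoring A) := by
  refine Nat.card_congr (Equiv.subtypeEquivRight fun p => ?_)
  by_cases h₁ : p.1 ∈ A <;> by_cases h₂ : p.2 ∈ A <;> simp [twoColoring, h₁, h₂]

/-- A connected labeled bipartite graph with an odd number of edges
and unequal bipartition has a non-palindromic (hence nonsymmetric) CQF. -/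
theorem stmt13 (n : ℕ) (G : SimpleGraph (Fin n)) (hconn : G.Connected)
    (A B : Finset (Fin n)) (hA : A.Nonempty) (hB : B.Nonempty)
    (hdisj : Disjoint A B) (hunion : A ∪ B = Finset.univ)
    (hAind : ∀ u ∈ A, ∀ v ∈ A, ¬ G.Adj u v)
    (hBind : ∀ u ∈ B, ∀ v ∈ B, ¬ G.Adj u v)
    (hcard : A.card ≠ B.card)
    (hodd : Odd (edgeCount G)) :
    ¬ cqfPalindromic G ∧ ¬ cqfSymmetric G := by
  obtain rfl : B = Aᶜ := (IsCompl.of_eq hdisj.eq_bot hunion).symm.eq_compl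
  have hproper := properColoring_twoColoring hAind hBind
  have hsum := ascNum_add_desNum G hproper
  have hiff := NG_pair_ne_zero_iff hconn hcard hproper (usesPalette_twoColoring A)
  have hiff' := NG_pair_ne_zero_iff (a := Aᶜ.card) (b := A.card) hconn hcard.symm
    (properColoring_twoColoring (A := Aᶜ) hBind (by simpa using hAind))
    (by simpa using usesPalette_twoColoring Aᶜ)
  rw [ascNum_twoColoring_compl] at hiff'
  have hcomp : IsComposition n [A.card, Aᶜ.card] :=
    ⟨by simp [hA.card_pos, hB.card_pos], by simp⟩
  have hcomp' : IsComposition n [Aᶜ.card, A.card] :=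
    ⟨by simp [hA.card_pos, hB.card_pos], by simp⟩
  have hne := (hiff _).2 rfl
  obtain ⟨r, hr⟩ := hodd
  constructor
  · intro h
    rw [h _ hcomp _ (by omega), hiff] at hne
    omega
  · intro h
    rw [h _ _ hcomp hcomp' (List.Perm.swap _ _ _), hiff'] at hne
    omega
end

section
/- Let w = (w_1,…,w_n) be a permutation of {1,…,n} whose ribbon composition (α_1,…,α_k) satisfies k ≥ 2 and α_i ≥ 2 for all 1 ≤ i ≤ k. Fix 1 ≤ i ≤ k−1, set r = α_i and s = α_{i+1}, and let b be any integer with r ≤ b ≤ n−k−s+2. Then N_{P_w}((k,1^{n−k}), n−1) > N_{P_w}((1^{b−1}, k, 1^{n−k−b+1}), n−1), where (k,1^{n−k}) denotes the composition of n with first part k followed by n−k parts equal to 1, and (1^{b−1}, k, 1^{n−k−b+1}) denotes the composition of n with b−1 parts equal to 1, then a part equal to k, then n−k−b+1 parts equal to 1. -/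
/-- The coloring `f` uses exactly the colors `1,…,m`, the color `b` being used `k` times and
every other color once. -/
def HasSinglePalette {X : Type*} (m b k : ℕ) (f : X → ℕ) : Prop :=
  (∀ x, 1 ≤ f x ∧ f x ≤ m) ∧
  ∀ v, 1 ≤ v → v ≤ m → Nat.card {x // f x = v} = if v = b then k else 1

/-- The cyclic relabeling of colors which sends `b` to `1` and shifts the colors below `b` up. -/
def colorCycle (b v : ℕ) : ℕ := if v = b then 1 else if v < b then v + 1 else v

/-- Sort the values of `g` inside each run. -/
def sortRuns {k : ℕ} {a : Fin k → ℕ} (g : (Σ j, Fin (a j)) → ℕ) (x : Σ j, Fin (a j)) : ℕ :=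
  g ⟨x.1, Tuple.sort (fun o => g ⟨x.1, o⟩) x.2⟩

/-- A coloring of the cells of a ribbon with run lengths `a` which increases along each run and
descends between consecutive runs. -/
structure IsRibbonColoring {k : ℕ} (a : Fin k → ℕ) (f : (Σ j, Fin (a j)) → ℕ) : Prop where
  ascent : ∀ j (o : ℕ) (h : o + 1 < a j), f ⟨j, o, by omega⟩ < f ⟨j, o + 1, h⟩
  descent : ∀ (j : ℕ) (h : j + 1 < k) (o : Fin (a ⟨j, by omega⟩)) (o' : Fin (a ⟨j + 1, h⟩)),
    (o : ℕ) + 1 = a ⟨j, by omega⟩ → (o' : ℕ) = 0 → f ⟨_, o'⟩ < f ⟨_, o⟩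

theorem Fin.strictMono_of_lt_add_one {N : ℕ} {g : Fin N → ℕ}
    (h : ∀ (o : ℕ) (ho : o + 1 < N), g ⟨o, by omega⟩ < g ⟨o + 1, ho⟩) : StrictMono g := by
  cases N with
  | zero => exact fun x => x.elim0
  | succ N => exact Fin.strictMono_iff_lt_succ.2 fun i => h i (by omega)

theorem colorCycle_injOn (b : ℕ) : Set.InjOn (colorCycle b) {v | 1 ≤ v} := by
  intro x hx y hy h
  simp only [colorCycle, Set.mem_ofPred_eq] at *
  grind

theorem HasSinglePalette.comp_equiv {X Y : Type*} {m b k : ℕ} {f : X → ℕ}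
    (hf : HasSinglePalette m b k f) (e : Y ≃ X) : HasSinglePalette m b k (f ∘ e) := by
  refine ⟨fun x => hf.1 _, fun v h1 h2 => ?_⟩
  rw [← hf.2 v h1 h2]
  exact Nat.card_congr (e.subtypeEquiv fun _ => Iff.rfl)

theorem HasSinglePalette.colorCycle {X : Type*} {m b k : ℕ} {f : X → ℕ}
    (hf : HasSinglePalette m b k f) (hb : 1 ≤ b) (hbm : b ≤ m) :
    HasSinglePalette m 1 k (colorCycle b ∘ f) := by
  refine ⟨fun x => ?_, fun v h1 h2 => ?_⟩
  · have := hf.1 x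
    simp only [Function.comp, _root_.colorCycle]
    grind
  · have key := hf.2 (if v = 1 then b else if v ≤ b then v - 1 else v) (by grind) (by grind)
    have : (if (if v = 1 then b else if v ≤ b then v - 1 else v) = b then k else 1)
        = if v = 1 then k else 1 := by grind
    rw [this] at key
    rw [← key]
    refine Nat.card_congr (Equiv.subtypeEquivRight fun x => ?_)
    have := hf.1 x
    simp only [Function.comp, _root_.colorCycle]
    grind

section Runs

variable {k : ℕ} {a : Fin k → ℕ}

theorem IsRibbonColoring.strictMono {f : (Σ j, Fin (a j)) → ℕ} (hf : IsRibbonColoring a f)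
    (j : Fin k) : StrictMono fun o => f ⟨j, o⟩ :=
  Fin.strictMono_of_lt_add_one (hf.ascent j)

theorem HasSinglePalette.sortRuns {m b : ℕ} {g : (Σ j, Fin (a j)) → ℕ}
    (hg : HasSinglePalette m b k g) : HasSinglePalette m b k (sortRuns g) :=
  hg.comp_equiv (Equiv.sigmaCongrRight fun j => Tuple.sort fun o => g ⟨j, o⟩)

theorem monotone_sortRuns (g : (Σ j, Fin (a j)) → ℕ) (j : Fin k) :
    Monotone fun o => sortRuns g ⟨j, o⟩ :=
  Tuple.monotone_sort fun o => g ⟨j, o⟩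

theorem range_sortRuns (g : (Σ j, Fin (a j)) → ℕ) (j : Fin k) :
    Set.range (fun o => sortRuns g ⟨j, o⟩) = Set.range fun o => g ⟨j, o⟩ :=
  (Tuple.sort fun o => g ⟨j, o⟩).surjective.range_comp fun o => g ⟨j, o⟩

/-- The repeated color occurs in every run. -/
theorem HasSinglePalette.exists_eq {m b : ℕ} {g : (Σ j, Fin (a j)) → ℕ}
    (hg : HasSinglePalette m b k g) (hinj : ∀ j, Function.Injective fun o => g ⟨j, o⟩)
    (hb : 1 ≤ b) (hbm : b ≤ m) (j : Fin k) : ∃ o, g ⟨j, o⟩ = b := by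
  have hcard : Fintype.card {x // g x = b} = Fintype.card (Fin k) := by
    rw [← Nat.card_eq_fintype_card, hg.2 b hb hbm, if_pos rfl, Fintype.card_fin]
  have hi : Function.Injective fun x : {x // g x = b} => x.1.1 := by
    rintro ⟨⟨j, o⟩, h⟩ ⟨⟨j', o'⟩, h'⟩ (rfl : j = j')
    obtain rfl := hinj j (h.trans h'.symm)
    rfl
  obtain ⟨⟨⟨j, o⟩, h⟩, rfl⟩ :=
    ((Fintype.bijective_iff_injective_and_card _).2 ⟨hi, hcard⟩).surjective j
  exact ⟨o, h⟩

theorem isRibbonColoring_sortRuns {m : ℕ} {g : (Σ j, Fin (a j)) → ℕ}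
    (ha : ∀ j, 2 ≤ a j) (hg : HasSinglePalette m 1 k g)
    (hinj : ∀ j, Function.Injective fun o => g ⟨j, o⟩) (hm : 1 ≤ m) :
    IsRibbonColoring a (sortRuns g) := by
  have hmono : ∀ j, StrictMono fun o => sortRuns g ⟨j, o⟩ := fun j =>
    (monotone_sortRuns g j).strictMono_of_injective
      ((hinj j).comp (Tuple.sort fun o => g ⟨j, o⟩).injective)
  refine ⟨fun j o h => hmono j (Fin.mk_lt_mk.2 (Nat.lt_succ_self o)), fun j h o o' ho ho' => ?_⟩
  obtain ⟨p, hp⟩ := hg.sortRuns.exists_eq (fun j => (hmono j).injective) le_rfl hm ⟨j + 1, h⟩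
  have h1 := (hmono ⟨j + 1, h⟩).monotone (show o' ≤ p by rw [Fin.le_def]; omega)
  have := ha ⟨j, by omega⟩
  have h2 := hmono ⟨j, by omega⟩
    (show (⟨0, by omega⟩ : Fin (a ⟨j, by omega⟩)) < o by rw [Fin.lt_def]; simp only; omega)
  have h3 := (hg.sortRuns.1 ⟨⟨j, by omega⟩, ⟨0, by omega⟩⟩).1
  simp only at h1 h2
  omega

/-- A coloring with repeated color `b` whose run `i` lies weakly below `b` and whose run `i + 1`
lies weakly above `b`. -/
theorem exists_separated_coloring {m b i : ℕ} (ha : ∀ j, 2 ≤ a j) (hi : i + 1 < k)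
    (hm : m + k = ∑ j, a j + 1) (hb1 : a ⟨i, by omega⟩ ≤ b) (hb2 : b + a ⟨i + 1, hi⟩ ≤ m + 1) :
    ∃ g : (Σ j, Fin (a j)) → ℕ, HasSinglePalette m b k g ∧
      (∀ j, Function.Injective fun o => g ⟨j, o⟩) ∧
      (∀ o : Fin (a ⟨i, by omega⟩), g ⟨_, o⟩ ≤ b) ∧ ∀ o : Fin (a ⟨i + 1, hi⟩), b ≤ g ⟨_, o⟩ := by
  classical
  have hai := ha ⟨i, by omega⟩
  have hai' := ha ⟨i + 1, hi⟩
  have hz : Fintype.card {x : Σ j, Fin (a j) // x.2.val = 0} = k := by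
    refine (Fintype.card_congr ⟨fun x => x.1.1, fun j => ⟨⟨j, 0, by have := ha j; omega⟩, rfl⟩,
      ?_, fun j => rfl⟩).trans (Fintype.card_fin k)
    rintro ⟨⟨j, o, ho⟩, h⟩
    simp only at h
    subst h
    rfl
  have hcard : Fintype.card {x : Σ j, Fin (a j) // ¬ x.2.val = 0}
      = ((Finset.Icc 1 m).erase b).card := by
    rw [Fintype.card_subtype_compl, hz, Finset.card_erase_of_mem (Finset.mem_Icc.2 (by omega)),
      Fintype.card_sigma]
    simp only [Fintype.card_fin, Nat.card_Icc]
    omega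
  obtain ⟨e, he⟩ := Finset.exists_equiv_extend_of_card_eq hcard
    (s := Finset.univ.filter fun x => x.1.1.val = i ∨ x.1.1.val = i + 1)
    (f := fun x => if x.1.1.val = i then x.1.2.val else b + x.1.2.val)
    (by
      intro v hv
      obtain ⟨⟨⟨⟨j, hj⟩, o, ho⟩, hx⟩, hs, rfl⟩ := Finset.mem_image.1 hv
      simp only [Finset.mem_filter, Finset.mem_univ, true_and] at hs hx
      simp only [Finset.mem_erase, Finset.mem_Icc]
      rcases hs with rfl | rfl
      · simp only [if_true]; omega
      · simp only [Nat.succ_ne_self, if_false]; omega)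
    (by
      rintro ⟨⟨⟨j, hj⟩, o, ho⟩, hx⟩ hs ⟨⟨⟨j', hj'⟩, o', ho'⟩, hx'⟩ hs' h
      simp only [Finset.coe_filter, Finset.mem_univ, true_and, Set.mem_ofPred_eq] at hs hs' hx hx' h
      rcases hs with rfl | rfl <;> rcases hs' with rfl | rfl <;>
        simp only [if_true, Nat.succ_ne_self, if_false] at h
      · subst h; rfl
      · omega
      · omega
      · obtain rfl : o = o' := by omega
        rfl)
  have hmem : ∀ x, (e x : ℕ) ≠ b ∧ 1 ≤ (e x : ℕ) ∧ (e x : ℕ) ≤ m := fun x => by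
    simpa only [Finset.mem_erase, Finset.mem_Icc] using (e x).2
  have hval : ∀ x : Σ j, Fin (a j), ∀ h : ¬ x.2.val = 0,
      (if h : x.2.val = 0 then b else (e ⟨x, h⟩ : ℕ)) = e ⟨x, h⟩ := fun x h => dif_neg h
  refine ⟨fun x => if h : x.2.val = 0 then b else e ⟨x, h⟩, ⟨fun x => ?_, fun v h1 h2 => ?_⟩,
    fun j o o' h => ?_, fun o => ?_, fun o => ?_⟩
  · dsimp only
    split_ifs with h
    · omega
    · exact (hmem _).2
  · split_ifs with hv
    · subst hv
      refine (Nat.card_congr (Equiv.subtypeEquivRight fun x => ?_)).trans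
        (Nat.card_eq_fintype_card.trans hz)
      by_cases h : x.2.val = 0
      · simp [h]
      · simp [h, (hmem ⟨x, h⟩).1]
    · obtain ⟨x, hx⟩ := e.surjective ⟨v, Finset.mem_erase.2 ⟨hv, Finset.mem_Icc.2 ⟨h1, h2⟩⟩⟩
      have hx' : (e x : ℕ) = v := congrArg Subtype.val hx
      rw [Nat.card_eq_one_iff_unique]
      refine ⟨⟨?_⟩, ⟨⟨x.1, (hval _ x.2).trans hx'⟩⟩⟩
      have huniq : ∀ y : {y : Σ j, Fin (a j) //
          (if h : y.2.val = 0 then b else (e ⟨y, h⟩ : ℕ)) = v}, y.1 = x.1 := by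
        rintro ⟨y, hy⟩
        by_cases h : y.2.val = 0
        · rw [dif_pos h] at hy; exact absurd hy.symm hv
        · rw [dif_neg h, ← hx'] at hy
          exact congrArg Subtype.val (e.injective (Subtype.ext hy))
      exact fun y y' => Subtype.ext ((huniq y).trans (huniq y').symm)
  · by_cases ho : o.val = 0 <;> by_cases ho' : o'.val = 0 <;>
      simp only [ho, ho', dif_pos, dif_neg, not_false_eq_true] at h
    · exact Fin.ext (ho.trans ho'.symm)
    · exact absurd h.symm (hmem _).1
    · exact absurd h (hmem _).1
    · simpa using e.injective (Subtype.ext h)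
  · dsimp only
    split_ifs with h
    · exact le_rfl
    · rw [he _ (by simp)]
      simp only [if_true]
      omega
  · dsimp only
    split_ifs with h
    · exact le_rfl
    · rw [he _ (by simp)]
      simp

theorem ncard_ribbonColoring_lt {m b i : ℕ} (ha : ∀ j, 2 ≤ a j) (hi : i + 1 < k)
    (hm : m + k = ∑ j, a j + 1) (hb1 : a ⟨i, by omega⟩ ≤ b) (hb2 : b + a ⟨i + 1, hi⟩ ≤ m + 1) :
    {f | HasSinglePalette m b k f ∧ IsRibbonColoring a f}.ncard <
      {f | HasSinglePalette m 1 k f ∧ IsRibbonColoring a f}.ncard := by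
  have hai := ha ⟨i, by omega⟩
  have hai' := ha ⟨i + 1, hi⟩
  have hb : 1 ≤ b := by omega
  have hbm : b ≤ m := by omega
  have hmaps : ∀ g : (Σ j, Fin (a j)) → ℕ, HasSinglePalette m b k g →
      (∀ j, Function.Injective fun o => g ⟨j, o⟩) →
      HasSinglePalette m 1 k (sortRuns (colorCycle b ∘ g)) ∧
        IsRibbonColoring a (sortRuns (colorCycle b ∘ g)) := fun g hg hinj =>
    ⟨(hg.colorCycle hb hbm).sortRuns, isRibbonColoring_sortRuns ha (hg.colorCycle hb hbm)
      (fun j o o' h => hinj j (colorCycle_injOn b (hg.1 _).1 (hg.1 _).1 h)) (by omega)⟩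
  have hrange : ∀ g g' : (Σ j, Fin (a j)) → ℕ, HasSinglePalette m b k g →
      HasSinglePalette m b k g' → sortRuns (colorCycle b ∘ g) = sortRuns (colorCycle b ∘ g') →
      ∀ j, Set.range (fun o => g ⟨j, o⟩) = Set.range fun o => g' ⟨j, o⟩ := by
    intro g g' hg hg' h j
    have h1 := range_sortRuns (colorCycle b ∘ g) j
    rw [h, range_sortRuns (colorCycle b ∘ g') j] at h1
    have h2 : colorCycle b '' Set.range (fun o => g ⟨j, o⟩)
        = colorCycle b '' Set.range fun o => g' ⟨j, o⟩ := by
      rw [← Set.range_comp, ← Set.range_comp]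
      exact h1.symm
    refine ((colorCycle_injOn b).image_eq_image_iff ?_ ?_).1 h2
    · rintro _ ⟨o, rfl⟩; exact (hg.1 _).1
    · rintro _ ⟨o, rfl⟩; exact (hg'.1 _).1
  have hinj : Set.InjOn (fun g => sortRuns (colorCycle b ∘ g))
      {f | HasSinglePalette m b k f ∧ IsRibbonColoring a f} := by
    intro f hf f' hf' h
    funext ⟨j, o⟩
    exact congrFun (((hf.2.strictMono j).range_inj (hf'.2.strictMono j)).1
      (hrange f f' hf.1 hf'.1 h j)) o
  rw [← hinj.ncard_image]
  refine Set.ncard_lt_ncard ?_ ((Set.Finite.pi' fun _ => Set.finite_Icc 1 m).subset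
    fun f hf x => hf.1.1 x)
  obtain ⟨g, hg, hginj, hlow, hhigh⟩ := exists_separated_coloring ha hi hm hb1 hb2
  refine Set.ssubset_iff_of_subset ?_ |>.2 ⟨sortRuns (colorCycle b ∘ g), hmaps g hg hginj, ?_⟩
  · rintro _ ⟨f, hf, rfl⟩
    exact hmaps f hf.1 fun j => (hf.2.strictMono j).injective
  · rintro ⟨f, hf, h⟩
    have hr := hrange f g hf.1 hg h
    have hd := hf.2.descent i hi ⟨a ⟨i, by omega⟩ - 1, Nat.sub_lt (by omega) one_pos⟩ ⟨0, by omega⟩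
      (Nat.sub_add_cancel (by omega)) rfl
    obtain ⟨p, hp⟩ :=
      (hr ⟨i, by omega⟩).subset ⟨⟨a ⟨i, by omega⟩ - 1, Nat.sub_lt (by omega) one_pos⟩, rfl⟩
    obtain ⟨q, hq⟩ := (hr ⟨i + 1, hi⟩).subset ⟨⟨0, by omega⟩, rfl⟩
    have h1 := hlow p
    have h2 := hhigh q
    simp only at hp hq
    omega

end Runs

theorem getElem?_ribbonWord (α : List ℕ) (h2 : ∀ a ∈ α, 2 ≤ a) (j o : ℕ) (hj : j < α.length)
    (ho : o < α[j]) (h : (α.take j).sum + o + 1 < α.sum) :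
    (ribbonWord α)[(α.take j).sum + o]? = some (decide (o + 1 < α[j])) := by
  induction α generalizing j with
  | nil => simp at hj
  | cons a t ih =>
    have ha := h2 a (by simp)
    cases t with
    | nil =>
      obtain rfl : j = 0 := by simpa using hj
      simp only [List.take_zero, List.sum_nil, List.sum_cons, List.getElem_cons_zero, zero_add,
        add_zero] at h ho ⊢
      rw [ribbonWord, List.getElem?_replicate, if_pos (by omega), decide_eq_true h]
    | cons c t =>
      rw [ribbonWord]
      cases j with
      | zero =>
        simp only [List.take_zero, List.sum_nil, List.getElem_cons_zero, zero_add] at ho ⊢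
        rw [List.getElem?_append]
        simp only [List.length_replicate, List.getElem?_replicate]
        split_ifs with h1
        · rw [decide_eq_true (by omega)]
        · obtain rfl : o = a - 1 := by omega
          simp
          omega
      | succ j =>
        simp only [List.take_succ_cons, List.sum_cons, List.getElem_cons_succ] at ho h ⊢
        have := ih (fun x hx => h2 x (List.mem_cons_of_mem _ hx)) j (by simpa using hj) ho
          (by simp only [List.sum_cons]; omega)
        rw [← this, List.getElem?_append_right (by simp; omega), List.length_replicate,
          show a + ((c :: t).take j).sum + o - (a - 1) = ((c :: t).take j).sum + o + 1 by omega,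
          List.getElem?_cons_succ]

/-- Coloring the path so that every edge is an ascent amounts to following the ad-pattern. -/
theorem ascNum_pathGraph_eq_iff {n : ℕ} (w : Equiv.Perm (Fin n)) (c : Fin n → ℕ) :
    ascNum (pathGraph w) c = n - 1 ↔ ∀ (p : ℕ) (h : p + 1 < n),
      (w ⟨p, by omega⟩ < w ⟨p + 1, h⟩ → c (w ⟨p, by omega⟩) < c (w ⟨p + 1, h⟩)) ∧
      (¬ w ⟨p, by omega⟩ < w ⟨p + 1, h⟩ → c (w ⟨p + 1, h⟩) < c (w ⟨p, by omega⟩)) := by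
  have hne : ∀ (p : ℕ) (h : p + 1 < n), w ⟨p, by omega⟩ ≠ w ⟨p + 1, h⟩ := fun p h he => by
    simpa using w.injective he
  let P : Fin (n - 1) → Prop := fun p =>
    (w ⟨p, by omega⟩ < w ⟨p + 1, by omega⟩ → c (w ⟨p, by omega⟩) < c (w ⟨p + 1, by omega⟩)) ∧
      (¬ w ⟨p, by omega⟩ < w ⟨p + 1, by omega⟩ →
        c (w ⟨p + 1, by omega⟩) < c (w ⟨p, by omega⟩))
  let q : Fin (n - 1) → Fin n × Fin n := fun p =>
    if w ⟨p, by omega⟩ < w ⟨p + 1, by omega⟩ then (w ⟨p, by omega⟩, w ⟨p + 1, by omega⟩)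
    else (w ⟨p + 1, by omega⟩, w ⟨p, by omega⟩)
  have hq : ∀ p, P p →
      (q p).1 < (q p).2 ∧ (pathGraph w).Adj (q p).1 (q p).2 ∧ c (q p).1 < c (q p).2 := by
    intro p hp
    have hn := hne p (by omega)
    by_cases h : w ⟨p, by omega⟩ < w ⟨p + 1, by omega⟩
    · simp only [q, if_pos h]
      exact ⟨h, ⟨hn, Or.inl ⟨p, by omega, rfl, rfl⟩⟩, hp.1 h⟩
    · simp only [q, if_neg h]
      exact ⟨lt_of_le_of_ne (not_lt.1 h) hn.symm, ⟨hn.symm, Or.inr ⟨p, by omega, rfl, rfl⟩⟩,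
        hp.2 h⟩
  have hcard : ascNum (pathGraph w) c = Nat.card {p // P p} := by
    refine (Nat.card_congr (Equiv.ofBijective
      (fun p : {p // P p} => (⟨q p.1, hq p.1 p.2⟩ : {x : Fin n × Fin n //
        x.1 < x.2 ∧ (pathGraph w).Adj x.1 x.2 ∧ c x.1 < c x.2})) ⟨?_, ?_⟩)).symm
    · rintro ⟨p, hp⟩ ⟨p', hp'⟩ h
      have h := congrArg Subtype.val h
      simp only [q] at h
      apply Subtype.ext
      apply Fin.ext
      split_ifs at h <;> simp only [Prod.mk.injEq, w.injective.eq_iff, Fin.mk.injEq] at h <;>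
        simp only <;> omega
    · rintro ⟨⟨x, y⟩, hxy, ⟨-, hadj⟩, hc⟩
      dsimp only at hadj
      rcases hadj with ⟨p, hp, rfl, rfl⟩ | ⟨p, hp, rfl, rfl⟩
      · exact ⟨⟨⟨p, by omega⟩, fun _ => hc, fun h => absurd hxy h⟩,
          Subtype.ext (if_pos hxy)⟩
      · exact ⟨⟨⟨p, by omega⟩, fun h => absurd hxy h.not_gt, fun _ => hc⟩,
          Subtype.ext (if_neg (not_lt_of_gt hxy))⟩
  have hall : Nat.card {p // P p} = n - 1 ↔ ∀ p, P p := by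
    classical
    rw [Nat.card_eq_fintype_card]
    constructor
    · intro h p
      by_contra hp
      have := Fintype.card_subtype_lt hp
      rw [h, Fintype.card_fin] at this
      exact lt_irrefl _ this
    · intro h
      rw [Fintype.card_congr (Equiv.subtypeUnivEquiv h), Fintype.card_fin]
  rw [hcard, hall]
  exact ⟨fun h p hp => h ⟨p, by omega⟩, fun h p => h p (by omega)⟩

theorem usesPalette_iff {n : ℕ} {b k q : ℕ} (hb : 1 ≤ b) (c : Fin n → ℕ) :
    usesPalette (List.replicate (b - 1) 1 ++ k :: List.replicate q 1) c ↔
      HasSinglePalette (b + q) b k c := by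
  have hlen : (List.replicate (b - 1) 1 ++ k :: List.replicate q 1).length = b + q := by
    simp; omega
  have hget : ∀ i h, (List.replicate (b - 1) 1 ++ k :: List.replicate q 1).get ⟨i, h⟩
      = if i + 1 = b then k else 1 := by
    intro i h
    rw [List.get_eq_getElem, List.getElem_append]
    split_ifs with h1 h2 h2
    · simp at h1; omega
    · simp
    · simp [show i - (b - 1) = 0 by omega]
    · simp only [List.length_replicate] at h1
      obtain ⟨r, hr⟩ : ∃ r, i - (b - 1) = r + 1 := ⟨i - b, by omega⟩
      simp [hr]
  refine and_congr (by rw [hlen]) ⟨fun h v h1 h2 => ?_, fun h i => ?_⟩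
  · have := h ⟨v - 1, by omega⟩
    rw [hget] at this
    simpa [Nat.sub_add_cancel h1] using this
  · rw [h _ (by omega) (by have := i.2; omega)]
    exact (hget i.1 i.2).symm

/-- The cells of a ribbon, read run by run. -/
theorem exists_ribbon_equiv (α : List ℕ) : ∃ e : (Σ j : Fin α.length, Fin (α.get j)) ≃ Fin α.sum,
    ∀ x, (e x : ℕ) = (α.take x.1).sum + x.2 := by
  have hsum : ∑ j, α.get j = α.sum := Fin.sum_univ_getElem α
  refine ⟨finSigmaFinEquiv.trans (finCongr hsum), fun ⟨⟨j, hj⟩, o⟩ => ?_⟩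
  suffices h : ∑ i : Fin j, α.get (Fin.castLE hj.le i) = (α.take j).sum by
    simp only [Equiv.trans_apply, finCongr_apply, Fin.val_cast, finSigmaFinEquiv_apply, ← h]
  clear o
  induction j with
  | zero => simp
  | succ j ih =>
    rw [List.sum_take_succ _ _ (by omega), ← ih (by omega), Fin.sum_univ_castSucc]
    rfl

theorem NG_pathGraph_eq {n : ℕ} (w : Equiv.Perm (Fin n)) (α : List ℕ) (hsum : α.sum = n)
    (hrib : adPattern w = ribbonWord α) (h2 : ∀ a ∈ α, 2 ≤ a) {b q : ℕ} (hb : 1 ≤ b) :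
    NG (pathGraph w) (List.replicate (b - 1) 1 ++ α.length :: List.replicate q 1) (n - 1) =
      {f | HasSinglePalette (b + q) b α.length f ∧ IsRibbonColoring α.get f}.ncard := by
  subst hsum
  obtain ⟨e, he⟩ := exists_ribbon_equiv α
  have hpat : ∀ x : Σ j : Fin α.length, Fin (α.get j), ∀ h : (e x : ℕ) + 1 < α.sum,
      (w (e x) < w ⟨e x + 1, h⟩ ↔ (x.2 : ℕ) + 1 < α.get x.1) := by
    intro x h
    have h1 := getElem?_ribbonWord α h2 x.1 x.2 x.1.2 x.2.2 (by rw [← he]; exact h)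
    rw [← he, ← hrib, adPattern, List.getElem?_ofFn, dif_pos (by omega)] at h1
    simpa using h1
  have hsame : ∀ j (o : ℕ) (h : o + 1 < α.get j),
      (e ⟨j, o + 1, h⟩ : ℕ) = e ⟨j, o, by omega⟩ + 1 := by
    intro j o h
    rw [he, he]
    simp only
    omega
  have hnext : ∀ (j : ℕ) (h : j + 1 < α.length) (o : Fin (α.get ⟨j, by omega⟩))
      (o' : Fin (α.get ⟨j + 1, h⟩)), (o : ℕ) + 1 = α.get ⟨j, by omega⟩ → (o' : ℕ) = 0 →
      (e ⟨_, o'⟩ : ℕ) = e ⟨_, o⟩ + 1 := by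
    intro j h o o' ho ho'
    rw [he, he]
    simp only [List.get_eq_getElem] at ho ⊢
    rw [List.sum_take_succ _ _ (by omega)]
    omega
  refine Nat.card_congr ((Equiv.arrowCongr (e.trans w) (Equiv.refl ℕ)).symm.subtypeEquiv
    fun c => ?_)
  have hf : (Equiv.arrowCongr (e.trans w) (Equiv.refl ℕ)).symm c = c ∘ (e.trans w) := rfl
  rw [hf]
  have hpal : usesPalette (List.replicate (b - 1) 1 ++ α.length :: List.replicate q 1) c ↔
      HasSinglePalette (b + q) b α.length (c ∘ (e.trans w)) := by
    rw [usesPalette_iff hb]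
    refine ⟨fun h => h.comp_equiv _, fun h => ?_⟩
    have := h.comp_equiv (e.trans w).symm
    rwa [Function.comp_assoc, Equiv.self_comp_symm, Function.comp_id] at this
  have hasc : ascNum (pathGraph w) c = α.sum - 1 ↔
      IsRibbonColoring α.get (c ∘ (e.trans w)) := by
    rw [ascNum_pathGraph_eq_iff]
    constructor
    · intro h
      refine ⟨fun j o ho => ?_, fun j hj o o' ho ho' => ?_⟩
      · have hs := hsame j o ho
        have hlt : (e ⟨j, o, by omega⟩ : ℕ) + 1 < α.sum := hs ▸ (e _).2
        have := (h _ hlt).1 ((hpat _ hlt).2 ho)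
        simp only [← hs] at this
        exact this
      · have hs := hnext j hj o o' ho ho'
        have hlt : (e ⟨_, o⟩ : ℕ) + 1 < α.sum := hs ▸ (e _).2
        have := (h _ hlt).2 (mt (hpat _ hlt).1 (by simp only; omega))
        simp only [← hs] at this
        exact this
    · intro h p hp
      obtain ⟨⟨⟨j, hj⟩, o⟩, hx⟩ := e.surjective ⟨p, by omega⟩
      obtain rfl : (e ⟨⟨j, hj⟩, o⟩ : ℕ) = p := congrArg Fin.val hx
      refine ⟨fun hw => ?_, fun hw => ?_⟩
      · have ho := (hpat _ hp).1 hw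
        have := h.ascent _ o ho
        have hs := hsame _ o ho
        simp only [← hs]
        exact this
      · have ho : ¬ (o : ℕ) + 1 < α.get ⟨j, hj⟩ := mt (hpat _ hp).2 hw
        have ho' : (o : ℕ) + 1 = α.get ⟨j, hj⟩ := by have := o.2; omega
        have hj' : j + 1 < α.length := by
          by_contra hcon
          have h1 := List.sum_take_succ α j hj
          rw [List.take_of_length_le (by omega)] at h1
          rw [he] at hp
          simp only [List.get_eq_getElem] at hp ho'
          omega
        have hpos := h2 _ (List.get_mem α ⟨j + 1, hj'⟩)
        have := h.descent j hj' o ⟨0, by omega⟩ ho' rfl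
        have hs := hnext j hj' o ⟨0, by omega⟩ ho' rfl
        simp only [← hs]
        exact this
  rw [Set.mem_ofPred_eq, ← hpal, ← hasc]
  refine ⟨fun h => h.2, fun h => ⟨?_, h⟩⟩
  have h := (ascNum_pathGraph_eq_iff w c).1 h.2
  rintro u v ⟨-, ⟨p, hp, rfl, rfl⟩ | ⟨p, hp, rfl, rfl⟩⟩
  · have := h p hp
    by_cases hw : w ⟨p, by omega⟩ < w ⟨p + 1, hp⟩
    · exact (this.1 hw).ne
    · exact (this.2 hw).ne'
  · have := h p hp
    by_cases hw : w ⟨p, by omega⟩ < w ⟨p + 1, hp⟩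
    · exact (this.1 hw).ne'
    · exact (this.2 hw).ne

/-- Let the ribbon composition `(α₁,…,α_k)` of `w` have `k ≥ 2`
parts, all at least `2`.  Fix adjacent parts `r = αᵢ`, `s = α_{i+1}` and any `b` with
`r ≤ b ≤ n - k - s + 2`.  Then
`N_{P_w}((k,1^{n-k}), n-1) > N_{P_w}((1^{b-1}, k, 1^{n-k-b+1}), n-1)`. -/
theorem stmt18 (n : ℕ) (w : Equiv.Perm (Fin n)) (α : List ℕ)
    (hcomp : IsComposition n α) (hrib : adPattern w = ribbonWord α)
    (hlen : 2 ≤ α.length) (h2 : ∀ a ∈ α, 2 ≤ a)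
    (i : ℕ) (hi : i + 1 < α.length) (b : ℕ)
    (hb1 : α.get ⟨i, by omega⟩ ≤ b)
    (hb2 : b ≤ n - α.length - α.get ⟨i + 1, hi⟩ + 2) :
    NG (pathGraph w) (α.length :: List.replicate (n - α.length) 1) (n - 1) >
      NG (pathGraph w)
        (List.replicate (b - 1) 1 ++ α.length :: List.replicate (n - α.length - b + 1) 1)
        (n - 1) := by
  have hsum : ∑ j, α.get j = n := (Fin.sum_univ_getElem α).trans hcomp.2
  have ha : ∀ j, 2 ≤ α.get j := fun j => h2 _ (List.get_mem α j)
  have hi1 := ha ⟨i, by omega⟩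
  have hi2 := ha ⟨i + 1, hi⟩
  have hbound : α.length + (α.get ⟨i, by omega⟩ - 1) + (α.get ⟨i + 1, hi⟩ - 1) ≤ n := by
    have hle := Finset.sum_le_univ_sum_of_nonneg (f := fun j => α.get j - 1)
      (s := {⟨i, by omega⟩, ⟨i + 1, hi⟩}) fun _ => Nat.zero_le _
    rw [Finset.sum_pair (by simp)] at hle
    have hshift : ∑ j, (α.get j - 1) + α.length = n := by
      calc ∑ j, (α.get j - 1) + α.length = ∑ j, (α.get j - 1 + 1) := by
            simp [Finset.sum_add_distrib]
        _ = n := by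
            rw [← hsum]
            exact Finset.sum_congr rfl fun j _ => Nat.sub_add_cancel (one_le_two.trans (ha j))
    omega
  have h1 := NG_pathGraph_eq w α hcomp.2 hrib h2 (b := 1) (q := n - α.length) le_rfl
  have hb := NG_pathGraph_eq w α hcomp.2 hrib h2 (b := b) (q := n - α.length - b + 1) (by omega)
  rw [show b + (n - α.length - b + 1) = 1 + (n - α.length) by omega] at hb
  rw [Nat.sub_self, List.replicate_zero, List.nil_append] at h1
  rw [gt_iff_lt, h1, hb]
  exact ncard_ribbonColoring_lt ha hi (by omega) hb1 (by omega)
end
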